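/- arXiv:1703.04058 — 7 statements merged into one kernel-verified Lean document; each statement's English description precedes it below -/
import Mathlib

section
/- Let p ≥ 1 and let γ : ℝ → ℝ^p be a smooth curve. Then, as t → 0, ‖γ(t) − γ(0)‖² = ‖γ'(0)‖²·t² + (γ''(0)·γ'(0))·t³ + ((1/3)·γ'''(0)·γ'(0) + (1/4)·‖γ''(0)‖²)·t⁴ + ((1/12)·γ⁽⁴⁾(0)·γ'(0) + (1/6)·γ'''(0)·γ''(0))·t⁵ + ((1/60)·γ⁽⁵⁾(0)·γ'(0) + (1/24)·γ⁽⁴⁾(0)·γ''(0) + (1/36)·‖γ'''(0)‖²)·t⁶ + O(t⁷). -/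
open Asymptotics Filter Topology
open scoped RealInnerProductSpace

/-- Taylor's theorem at a point, with a big-O remainder one order above the polynomial. -/
theorem taylor_isBigO_univ {E : Type*} [NormedAddCommGroup E] [NormedSpace ℝ E]
    {f : ℝ → E} {x₀ : ℝ} {n : ℕ} (hf : ContDiff ℝ (n + 1 : ℕ) f) :
    (fun x => f x - taylorWithinEval f n Set.univ x₀ x)
      =O[𝓝 x₀] fun x => (x - x₀) ^ (n + 1) := by
  have h := (taylor_isLittleO_univ (x₀ := x₀) hf).isBigO
  have h' : (fun x => (((n + 1 : ℝ) * n.factorial)⁻¹ * (x - x₀) ^ (n + 1)) •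
      iteratedDerivWithin (n + 1) f Set.univ x₀) =O[𝓝 x₀] fun x => (x - x₀) ^ (n + 1) := by
    refine IsBigO.of_bound
      (‖((n + 1 : ℝ) * n.factorial)⁻¹‖ * ‖iteratedDerivWithin (n + 1) f Set.univ x₀‖)
      (Eventually.of_forall fun x => ?_)
    rw [norm_smul, norm_mul]
    exact le_of_eq (by ring)
  refine (h.add h').congr_left fun x => ?_
  rw [taylorWithinEval_succ]
  abel

/-- The squared norm of a quintic vector polynomial with no constant term. -/
theorem norm_sq_quintic {E : Type*} [NormedAddCommGroup E] [InnerProductSpace ℝ E]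
    (a b c d e : E) (t : ℝ) :
    ‖t • a + (t ^ 2 / 2) • b + (t ^ 3 / 6) • c + (t ^ 4 / 24) • d + (t ^ 5 / 120) • e‖ ^ 2 =
      (‖a‖ ^ 2 * t ^ 2 + ⟪b, a⟫ * t ^ 3 +
        ((1 / 3) * ⟪c, a⟫ + (1 / 4) * ‖b‖ ^ 2) * t ^ 4 +
        ((1 / 12) * ⟪d, a⟫ + (1 / 6) * ⟪c, b⟫) * t ^ 5 +
        ((1 / 60) * ⟪e, a⟫ + (1 / 24) * ⟪d, b⟫ + (1 / 36) * ‖c‖ ^ 2) * t ^ 6) +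
      t ^ 7 * (⟪e, b⟫ / 120 + ⟪d, c⟫ / 72 + (‖d‖ ^ 2 / 576 + ⟪e, c⟫ / 360) * t +
        ⟪e, d⟫ / 1440 * t ^ 2 + ‖e‖ ^ 2 / 14400 * t ^ 3) := by
  simp only [← real_inner_self_eq_norm_sq, inner_add_left, inner_add_right,
    real_inner_smul_left, real_inner_smul_right]
  rw [real_inner_comm b a, real_inner_comm c a, real_inner_comm d a, real_inner_comm e a,
    real_inner_comm c b, real_inner_comm d b, real_inner_comm e b, real_inner_comm d c,
    real_inner_comm e c, real_inner_comm e d]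
  ring

/-- Sixth-order expansion of the squared chordal distance `‖γ(t) − γ(0)‖²` of a smooth
curve in `ℝ^p`, as `t → 0`. -/
theorem chordal_distance_sq_expansion
    (p : ℕ) (hp : 1 ≤ p)
    (γ : ℝ → EuclideanSpace ℝ (Fin p))
    (hγ : ContDiff ℝ (⊤ : ℕ∞) γ) :
    (fun t => ‖γ t - γ 0‖ ^ 2 -
        (‖iteratedDeriv 1 γ 0‖ ^ 2 * t ^ 2 +
          ⟪iteratedDeriv 2 γ 0, iteratedDeriv 1 γ 0⟫ * t ^ 3 +
          ((1 / 3) * ⟪iteratedDeriv 3 γ 0, iteratedDeriv 1 γ 0⟫ +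
            (1 / 4) * ‖iteratedDeriv 2 γ 0‖ ^ 2) * t ^ 4 +
          ((1 / 12) * ⟪iteratedDeriv 4 γ 0, iteratedDeriv 1 γ 0⟫ +
            (1 / 6) * ⟪iteratedDeriv 3 γ 0, iteratedDeriv 2 γ 0⟫) * t ^ 5 +
          ((1 / 60) * ⟪iteratedDeriv 5 γ 0, iteratedDeriv 1 γ 0⟫ +
            (1 / 24) * ⟪iteratedDeriv 4 γ 0, iteratedDeriv 2 γ 0⟫ +
            (1 / 36) * ‖iteratedDeriv 3 γ 0‖ ^ 2) * t ^ 6))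
      =O[𝓝 (0 : ℝ)] fun t => t ^ 7 := by
  set a := iteratedDeriv 1 γ 0
  set b := iteratedDeriv 2 γ 0
  set c := iteratedDeriv 3 γ 0
  set d := iteratedDeriv 4 γ 0
  set e := iteratedDeriv 5 γ 0
  let P : ℝ → EuclideanSpace ℝ (Fin p) := fun t =>
    t • a + (t ^ 2 / 2) • b + (t ^ 3 / 6) • c + (t ^ 4 / 24) • d + (t ^ 5 / 120) • e
  have hR : (fun t => γ t - γ 0 - P t) =O[𝓝 0] fun t => t ^ 6 := by
    have h := taylor_isBigO_univ (x₀ := 0) (n := 5) (contDiff_infty.1 hγ _)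
    refine h.congr (fun t => ?_) fun t => by simp
    simp only [P, a, b, c, d, e, taylor_within_apply, Finset.sum_range_succ, Finset.sum_range_zero,
      iteratedDerivWithin_univ, iteratedDeriv_zero, Nat.factorial, sub_zero]
    push_cast
    module
  have hP : P =O[𝓝 0] fun t => t := by
    have hd : DifferentiableAt ℝ P 0 := by fun_prop
    simpa [P] using hd.isBigO_sub
  have hPR : (fun t => 2 * ⟪P t, γ t - γ 0 - P t⟫) =O[𝓝 0] fun t => t ^ 7 := by
    refine IsBigO.const_mul_left ?_ 2
    refine (IsBigO.of_norm_le fun t => norm_inner_le_norm (𝕜 := ℝ) _ _).trans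
      ((hP.norm_left.mul hR.norm_left).congr_right fun t => by ring)
  have hRR : (fun t => ‖γ t - γ 0 - P t‖ ^ 2) =O[𝓝 0] fun t => t ^ 7 :=
    (hR.norm_left.pow 2).trans
      (((isBigO_refl (fun t : ℝ => t ^ 7) (𝓝 0)).mul
        ((continuous_pow 5).tendsto (0 : ℝ) |>.isBigO_one ℝ)).congr
        (fun t => by ring) fun t => by ring)
  have hQ : (fun t => t ^ 7 * (⟪e, b⟫ / 120 + ⟪d, c⟫ / 72 +
      (‖d‖ ^ 2 / 576 + ⟪e, c⟫ / 360) * t + ⟪e, d⟫ / 1440 * t ^ 2 + ‖e‖ ^ 2 / 14400 * t ^ 3))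
      =O[𝓝 0] fun t => t ^ 7 := by
    have hc : Continuous fun t : ℝ => ⟪e, b⟫ / 120 + ⟪d, c⟫ / 72 +
        (‖d‖ ^ 2 / 576 + ⟪e, c⟫ / 360) * t + ⟪e, d⟫ / 1440 * t ^ 2 + ‖e‖ ^ 2 / 14400 * t ^ 3 := by
      fun_prop
    simpa using (isBigO_refl (fun t : ℝ => t ^ 7) (𝓝 0)).mul ((hc.tendsto 0).isBigO_one ℝ)
  refine ((hQ.add hPR).add hRR).congr_left fun t => ?_
  have hsq := norm_add_sq_real (P t) (γ t - γ 0 - P t)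
  rw [add_sub_cancel] at hsq
  rw [hsq, norm_sq_quintic a b c d e t]
  ring
end

section
/- Let p ≥ 1 and let γ : ℝ → ℝ^p be a smooth curve with ‖γ'(t)‖ = 1 for all t in an open interval containing 0. Then, as t → 0, ‖γ(t) − γ(0)‖² = t² − (1/12)·‖γ''(0)‖²·t⁴ − (1/12)·(γ'''(0)·γ''(0))·t⁵ − ((1/40)·γ⁽⁴⁾(0)·γ''(0) + (1/45)·‖γ'''(0)‖²)·t⁶ + O(t⁷). -/
open Asymptotics Filter Topology
open scoped RealInnerProductSpace

/-- A function vanishing on an open interval has vanishing derivative there. -/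
lemma HasDerivAt.eq_zero_of_forall_Ioo_eq {f : ℝ → ℝ} {f' c t a b : ℝ}
    (hf : HasDerivAt f f' t) (ht : t ∈ Set.Ioo a b) (hc : ∀ s ∈ Set.Ioo a b, f s = c) :
    f' = 0 := by
  have hev : f =ᶠ[𝓝 t] fun _ => c :=
    Filter.eventually_of_mem (Ioo_mem_nhds ht.1 ht.2) hc
  exact (hf.congr_of_eventuallyEq hev.symm).unique (hasDerivAt_const t c)

/-- The iterated derivatives of a smooth curve differentiate into one another. -/
lemma ContDiff.hasDerivAt_iteratedDeriv {E : Type*} [NormedAddCommGroup E] [NormedSpace ℝ E]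
    {γ : ℝ → E} (hγ : ContDiff ℝ (⊤ : ℕ∞) γ) (k : ℕ) (t : ℝ) :
    HasDerivAt (iteratedDeriv k γ) (iteratedDeriv (k + 1) γ t) t := by
  rw [iteratedDeriv_succ]
  exact (hγ.differentiable_iteratedDeriv k (by exact_mod_cast WithTop.coe_lt_top k) t).hasDerivAt

/-- The fifth order Taylor expansion of a smooth curve at the origin. -/
lemma ContDiff.sub_taylor_five_isBigO {E : Type*} [NormedAddCommGroup E] [NormedSpace ℝ E]
    {γ : ℝ → E} (hγ : ContDiff ℝ (⊤ : ℕ∞) γ) :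
    (fun t => γ t - γ 0 - (t • iteratedDeriv 1 γ 0 + (t ^ 2 / 2) • iteratedDeriv 2 γ 0 +
        (t ^ 3 / 6) • iteratedDeriv 3 γ 0 + (t ^ 4 / 24) • iteratedDeriv 4 γ 0 +
        (t ^ 5 / 120) • iteratedDeriv 5 γ 0)) =O[𝓝 (0 : ℝ)] fun t => t ^ 6 := by
  have h := (taylor_isLittleO_univ (x₀ := 0) (n := 6)
    (contDiff_infty.1 hγ 6)).isBigO
  simp only [sub_zero] at h
  have h6 : (fun t : ℝ => (t ^ 6 / 720) • iteratedDeriv 6 γ 0) =O[𝓝 (0 : ℝ)] fun t => t ^ 6 := by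
    refine IsBigO.of_bound (‖iteratedDeriv 6 γ 0‖) (Eventually.of_forall fun t => ?_)
    rw [norm_smul, mul_comm, norm_div]
    gcongr
    exact div_le_self (norm_nonneg _) (by norm_num)
  refine (h.add h6).congr_left fun t => ?_
  simp only [taylor_within_apply, iteratedDerivWithin_univ, Finset.sum_range_succ,
    Finset.sum_range_zero, sub_zero, Nat.factorial, iteratedDeriv_zero]
  push_cast
  norm_num
  module

/-- Relations between the derivatives of a unit-speed curve, obtained by differentiating
`‖γ'‖² = 1` up to four times. -/
lemma inner_iteratedDeriv_of_unit_speed {E : Type*} [NormedAddCommGroup E] [InnerProductSpace ℝ E]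
    {γ : ℝ → E} (hγ : ContDiff ℝ (⊤ : ℕ∞) γ) {a b : ℝ}
    (hunit : ∀ t ∈ Set.Ioo a b, ‖deriv γ t‖ = 1) {t : ℝ} (ht : t ∈ Set.Ioo a b) :
    ⟪iteratedDeriv 1 γ t, iteratedDeriv 1 γ t⟫ = 1 ∧
    ⟪iteratedDeriv 1 γ t, iteratedDeriv 2 γ t⟫ = 0 ∧
    ⟪iteratedDeriv 1 γ t, iteratedDeriv 3 γ t⟫ = -⟪iteratedDeriv 2 γ t, iteratedDeriv 2 γ t⟫ ∧
    ⟪iteratedDeriv 1 γ t, iteratedDeriv 4 γ t⟫ =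
      -3 * ⟪iteratedDeriv 2 γ t, iteratedDeriv 3 γ t⟫ ∧
    ⟪iteratedDeriv 1 γ t, iteratedDeriv 5 γ t⟫ =
      -4 * ⟪iteratedDeriv 2 γ t, iteratedDeriv 4 γ t⟫ -
        3 * ⟪iteratedDeriv 3 γ t, iteratedDeriv 3 γ t⟫ := by
  have hd (i j : ℕ) (s : ℝ) := (hγ.hasDerivAt_iteratedDeriv i s).inner ℝ
    (hγ.hasDerivAt_iteratedDeriv j s)
  have r0 : ∀ s ∈ Set.Ioo a b, ⟪iteratedDeriv 1 γ s, iteratedDeriv 1 γ s⟫ = 1 := fun s hs => by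
    rw [iteratedDeriv_one, real_inner_self_eq_norm_sq, hunit s hs, one_pow]
  have r1 : ∀ s ∈ Set.Ioo a b, ⟪iteratedDeriv 1 γ s, iteratedDeriv 2 γ s⟫ = 0 := fun s hs => by
    have h := (hd 1 1 s).eq_zero_of_forall_Ioo_eq hs r0
    rw [real_inner_comm (iteratedDeriv 1 γ s)] at h
    linarith
  have r2 : ∀ s ∈ Set.Ioo a b, ⟪iteratedDeriv 1 γ s, iteratedDeriv 3 γ s⟫ +
      ⟪iteratedDeriv 2 γ s, iteratedDeriv 2 γ s⟫ = 0 := fun s hs =>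
    (hd 1 2 s).eq_zero_of_forall_Ioo_eq hs r1
  have r3 : ∀ s ∈ Set.Ioo a b, ⟪iteratedDeriv 1 γ s, iteratedDeriv 4 γ s⟫ +
      3 * ⟪iteratedDeriv 2 γ s, iteratedDeriv 3 γ s⟫ = 0 := fun s hs => by
    have h := ((hd 1 3 s).add (hd 2 2 s)).eq_zero_of_forall_Ioo_eq hs r2
    rw [real_inner_comm (iteratedDeriv 2 γ s) (iteratedDeriv (2 + 1) γ s)] at h
    simp only [Nat.reduceAdd] at h
    linarith
  have r4 : ⟪iteratedDeriv 1 γ t, iteratedDeriv 5 γ t⟫ +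
      4 * ⟪iteratedDeriv 2 γ t, iteratedDeriv 4 γ t⟫ +
      3 * ⟪iteratedDeriv 3 γ t, iteratedDeriv 3 γ t⟫ = 0 := by
    have h := ((hd 1 4 t).add ((hd 2 3 t).const_mul 3)).eq_zero_of_forall_Ioo_eq ht r3
    simp only [Nat.reduceAdd] at h
    linarith
  exact ⟨r0 t ht, r1 t ht, by linarith [r2 t ht], by linarith [r3 t ht], by linarith⟩

/-- Sixth-order expansion of `‖γ(t) − γ(0)‖²` for a smooth unit-speed curve, as `t → 0`. -/
theorem chordal_distance_sq_expansion_unit_speed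
    (p : ℕ) (hp : 1 ≤ p)
    (γ : ℝ → EuclideanSpace ℝ (Fin p))
    (hγ : ContDiff ℝ (⊤ : ℕ∞) γ)
    (a b : ℝ) (ha : a < 0) (hb : 0 < b)
    (hunit : ∀ t ∈ Set.Ioo a b, ‖deriv γ t‖ = 1) :
    (fun t => ‖γ t - γ 0‖ ^ 2 -
        (t ^ 2 - (1 / 12) * ‖iteratedDeriv 2 γ 0‖ ^ 2 * t ^ 4 -
          (1 / 12) * ⟪iteratedDeriv 3 γ 0, iteratedDeriv 2 γ 0⟫ * t ^ 5 -
          ((1 / 40) * ⟪iteratedDeriv 4 γ 0, iteratedDeriv 2 γ 0⟫ +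
            (1 / 45) * ‖iteratedDeriv 3 γ 0‖ ^ 2) * t ^ 6))
      =O[𝓝 (0 : ℝ)] fun t => t ^ 7 := by
  obtain ⟨h11, h12, h13, h14, h15⟩ := inner_iteratedDeriv_of_unit_speed hγ hunit ⟨ha, hb⟩
  have hR := hγ.sub_taylor_five_isBigO
  set g1 := iteratedDeriv 1 γ 0
  set g2 := iteratedDeriv 2 γ 0
  set g3 := iteratedDeriv 3 γ 0
  set g4 := iteratedDeriv 4 γ 0
  set g5 := iteratedDeriv 5 γ 0
  set P : ℝ → EuclideanSpace ℝ (Fin p) := fun t => t • g1 + (t ^ 2 / 2) • g2 +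
    (t ^ 3 / 6) • g3 + (t ^ 4 / 24) • g4 + (t ^ 5 / 120) • g5 with hP
  have hPO : P =O[𝓝 0] fun t : ℝ => t := by
    have hPd : DifferentiableAt ℝ P 0 := by fun_prop
    simpa [hP] using hPd.isBigO_sub
  have hQO : (fun t => γ t - γ 0) =O[𝓝 0] fun t : ℝ => t := by
    simpa using (hγ.differentiable (by simp) 0).isBigO_sub
  have hcross : (fun t => ⟪γ t - γ 0 - P t, γ t - γ 0 + P t⟫) =O[𝓝 (0 : ℝ)] fun t => t ^ 7 := by
    refine (IsBigO.of_bound 1 (Eventually.of_forall fun t => ?_)).trans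
      ((hR.norm_left.mul (hQO.add hPO).norm_left).congr_right fun t => by ring)
    simpa using abs_real_inner_le_norm _ _
  let q : ℝ → ℝ := fun t =>
    2 * (⟪g2, g5⟫ / 240 + ⟪g3, g4⟫ / 144) + (⟪g4, g4⟫ / 576 + ⟪g3, g5⟫ / 360) * t +
      ⟪g4, g5⟫ / 1440 * t ^ 2 + ⟪g5, g5⟫ / 14400 * t ^ 3
  have hpoly : (fun t => q t * t ^ 7) =O[𝓝 (0 : ℝ)] fun t => t ^ 7 := by
    have hq : q =O[𝓝 0] fun _ => (1 : ℝ) :=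
      (show Continuous q by fun_prop).continuousAt.isBigO_one ℝ
    simpa using hq.mul (isBigO_refl (fun t : ℝ => t ^ 7) (𝓝 0))
  refine (hcross.add hpoly).congr_left fun t => ?_
  have hdiff : ⟪γ t - γ 0 - P t, γ t - γ 0 + P t⟫ = ‖γ t - γ 0‖ ^ 2 - ⟪P t, P t⟫ := by
    generalize P t = v
    rw [← real_inner_self_eq_norm_sq, inner_sub_left, inner_add_right, inner_add_right,
      real_inner_comm v (γ t - γ 0)]
    ring
  have hPP : ⟪P t, P t⟫ = t ^ 2 - (1 / 12) * ‖g2‖ ^ 2 * t ^ 4 - (1 / 12) * ⟪g3, g2⟫ * t ^ 5 -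
      ((1 / 40) * ⟪g4, g2⟫ + (1 / 45) * ‖g3‖ ^ 2) * t ^ 6 + q t * t ^ 7 := by
    simp only [hP, q, inner_add_left, inner_add_right, real_inner_smul_left,
      real_inner_smul_right, ← real_inner_self_eq_norm_sq]
    rw [real_inner_comm g1 g2, real_inner_comm g1 g3, real_inner_comm g1 g4,
      real_inner_comm g1 g5, real_inner_comm g2 g3, real_inner_comm g2 g4,
      real_inner_comm g2 g5, real_inner_comm g3 g4, real_inner_comm g3 g5,
      real_inner_comm g4 g5, h11, h12, h13, h14, h15]
    ring
  rw [hdiff, hPP]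
  ring
end

section
/- Let p ≥ 2 be an integer. Then, as r → 0⁺, (∫₀^r (1 − cos t)·(sin t)^{p−2} dt)/(∫₀^r (1 − cos t)²·(sin t)^{p−2} dt + r^{p+7}) = 2(p+3)/((p+1)·r²) + (p² + 14p − 3)/(6(p+1)(p+5)) + O(r²). -/
open Asymptotics Filter Topology MeasureTheory

/-- The two-term expansion `f t = a t ^ k + b t ^ (k + 2) + O(t ^ (k + 4))` as `t → 0⁺`. -/
def HasTwoTermExpansion (f : ℝ → ℝ) (k : ℕ) (a b : ℝ) : Prop :=
  (fun t => f t - (a * t ^ k + b * t ^ (k + 2))) =O[𝓝[>] (0 : ℝ)] fun t => t ^ (k + 4)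

lemma isBigO_pow_nhdsGT_zero {m n : ℕ} (h : m ≤ n) :
    (fun t : ℝ => t ^ n) =O[𝓝[>] (0 : ℝ)] fun t => t ^ m := by
  refine IsBigO.mono ?_ nhdsWithin_le_nhds
  obtain rfl | h := h.eq_or_lt
  · exact isBigO_refl _ _
  · exact (isLittleO_pow_pow h).isBigO

namespace HasTwoTermExpansion

variable {f g : ℝ → ℝ} {k l : ℕ} {a b c d : ℝ}

lemma sub_leading (hf : HasTwoTermExpansion f k a b) :
    (fun t => f t - a * t ^ k) =O[𝓝[>] (0 : ℝ)] fun t => t ^ (k + 2) := by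
  have h₁ := IsBigO.trans hf (isBigO_pow_nhdsGT_zero (m := k + 2) (by omega))
  have h₂ := (isBigO_refl (fun t : ℝ => t ^ (k + 2)) (𝓝[>] 0)).const_mul_left b
  exact (h₁.add h₂).congr_left fun t => by ring

lemma isBigO (hf : HasTwoTermExpansion f k a b) :
    f =O[𝓝[>] (0 : ℝ)] fun t => t ^ k := by
  have h₁ := hf.sub_leading.trans (isBigO_pow_nhdsGT_zero (m := k) (by omega))
  have h₂ := (isBigO_refl (fun t : ℝ => t ^ k) (𝓝[>] 0)).const_mul_left a
  exact (h₁.add h₂).congr_left fun t => by ring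

lemma add_isBigO (hf : HasTwoTermExpansion f k a b)
    (hg : g =O[𝓝[>] (0 : ℝ)] fun t => t ^ (k + 4)) :
    HasTwoTermExpansion (fun t => f t + g t) k a b :=
  (IsBigO.add hf hg).congr_left fun t => by ring

lemma mul (hf : HasTwoTermExpansion f k a b) (hg : HasTwoTermExpansion g l c d) :
    HasTwoTermExpansion (fun t => f t * g t) (k + l) (a * c) (a * d + b * c) := by
  have h₁ := (IsBigO.mul hf hg.isBigO).congr_right (g₂ := fun t : ℝ => t ^ (k + l + 4))
    fun t => by ring
  have h₂ := ((isBigO_refl (fun t : ℝ => t ^ k) (𝓝[>] 0)).const_mul_left a).mul hg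
    |>.congr_right (g₂ := fun t : ℝ => t ^ (k + l + 4)) fun t => by ring
  have h₃ := ((isBigO_refl (fun t : ℝ => t ^ (k + 2)) (𝓝[>] 0)).const_mul_left b).mul
    hg.sub_leading |>.congr_right (g₂ := fun t : ℝ => t ^ (k + l + 4)) fun t => by ring
  exact ((h₁.add h₂).add h₃).congr_left fun t => by ring

lemma pow (hf : HasTwoTermExpansion f 1 1 b) (n : ℕ) :
    HasTwoTermExpansion (fun t => f t ^ n) n 1 (n * b) := by
  induction n with
  | zero => simpa [HasTwoTermExpansion] using isBigO_zero _ _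
  | succ n ih =>
    have h := ih.mul hf
    simp only [← pow_succ] at h
    convert h using 1
    · ring
    · push_cast; ring

lemma integral (hf : HasTwoTermExpansion f k a b) (hc : Continuous f) :
    HasTwoTermExpansion (fun r => ∫ t in (0 : ℝ)..r, f t) (k + 1) (a / (k + 1)) (b / (k + 3)) := by
  obtain ⟨C, hC⟩ := IsBigO.bound hf
  obtain ⟨ε, hε, hεC⟩ := mem_nhdsGT_iff_exists_Ioo_subset.1 hC
  refine IsBigO.of_bound C ?_
  filter_upwards [Ioo_mem_nhdsGT hε] with r hr
  have hr₀ : 0 < r := hr.1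
  have hpoly : ∫ t in (0 : ℝ)..r, (a * t ^ k + b * t ^ (k + 2)) =
      a / (k + 1) * r ^ (k + 1) + b / (k + 3) * r ^ (k + 1 + 2) := by
    rw [intervalIntegral.integral_add (Continuous.intervalIntegrable (by fun_prop) _ _)
      (Continuous.intervalIntegrable (by fun_prop) _ _), intervalIntegral.integral_const_mul,
      intervalIntegral.integral_const_mul, integral_pow, integral_pow]
    have h₁ : (k : ℝ) + 1 ≠ 0 := by positivity
    have h₃ : (k : ℝ) + 3 ≠ 0 := by positivity
    have h₃' : (k : ℝ) + 2 + 1 = k + 3 := by ring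
    push_cast
    rw [h₃']
    field_simp
    ring
  rw [← hpoly, ← intervalIntegral.integral_sub (hc.intervalIntegrable _ _)
    (Continuous.intervalIntegrable (by fun_prop) _ _)]
  have hbound : ∀ t ∈ Set.uIoc 0 r,
      ‖f t - (a * t ^ k + b * t ^ (k + 2))‖ ≤ C * r ^ (k + 4) := by
    intro t ht
    rw [Set.uIoc_of_le hr₀.le] at ht
    have htC : ‖f t - (a * t ^ k + b * t ^ (k + 2))‖ ≤ C * ‖t ^ (k + 4)‖ :=
      hεC ⟨ht.1, ht.2.trans_lt hr.2⟩
    have htk : 0 < t ^ (k + 4) := pow_pos ht.1 _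
    rw [Real.norm_of_nonneg htk.le] at htC
    have hC₀ : 0 ≤ C := nonneg_of_mul_nonneg_left ((norm_nonneg _).trans htC) htk
    exact htC.trans (by gcongr; exacts [ht.1.le, ht.2])
  refine (intervalIntegral.norm_integral_le_of_norm_le_const hbound).trans_eq ?_
  rw [sub_zero, abs_of_pos hr₀, Real.norm_of_nonneg (by positivity)]
  ring

lemma div (hf : HasTwoTermExpansion f k a b) (hg : HasTwoTermExpansion g (k + 2) c d)
    (hc : c ≠ 0) {u v : ℝ} (ha : a = u * c) (hb : b = u * d + v * c) :
    (fun r => f r / g r - (u / r ^ 2 + v)) =O[𝓝[>] (0 : ℝ)] fun r => r ^ 2 := by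
  have hg_equiv : g ~[𝓝[>] (0 : ℝ)] fun t => c * t ^ (k + 2) := by
    refine (hg.sub_leading.trans_isLittleO ?_).const_mul_right hc
    exact (isLittleO_pow_pow (by omega)).mono nhdsWithin_le_nhds
  have hlower : (fun t : ℝ => t ^ (k + 2)) =O[𝓝[>] (0 : ℝ)] g :=
    ((isBigO_refl _ _).const_mul_right hc).trans hg_equiv.isBigO_symm
  have hpos : ∀ᶠ t : ℝ in 𝓝[>] 0, 0 < t := self_mem_nhdsWithin
  have hg_ne : ∀ᶠ t in 𝓝[>] (0 : ℝ), g t ≠ 0 := by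
    filter_upwards [hlower.eq_zero_imp, hpos] with t ht ht₀ h
    exact (pow_pos ht₀ _).ne' (ht h)
  have hinv : (fun t => (g t)⁻¹) =O[𝓝[>] (0 : ℝ)] fun t => (t ^ (k + 2))⁻¹ := by
    refine hlower.inv_rev ?_
    filter_upwards [hpos] with t ht h
    exact absurd h (pow_pos ht _).ne'
  have h₁ : (fun r => (u / r ^ 2) * (g r - (c * r ^ (k + 2) + d * r ^ (k + 2 + 2))))
      =O[𝓝[>] (0 : ℝ)] fun r => r ^ (k + 4) := by
    refine (((isBigO_refl (fun r : ℝ => (r ^ 2)⁻¹) (𝓝[>] 0)).const_mul_left u).mul hg).congr'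
      (.of_forall fun r => by simp only [div_eq_mul_inv]) ?_
    filter_upwards [hpos] with r hr
    field_simp
    ring
  have h₂ := hg.sub_leading.const_mul_left v
  have hnum : (fun r => f r - (u / r ^ 2 + v) * g r) =O[𝓝[>] (0 : ℝ)] fun r => r ^ (k + 4) := by
    refine ((IsBigO.sub hf h₁).sub h₂).congr' ?_ (.of_forall fun r => rfl)
    filter_upwards [hpos] with r hr
    rw [ha, hb]
    field_simp
    ring
  refine (hnum.mul hinv).congr' ?_ ?_
  · filter_upwards [hg_ne] with r hr
    field_simp
  · filter_upwards [hpos] with r hr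
    field_simp
    ring

end HasTwoTermExpansion

lemma hasTwoTermExpansion_cos : HasTwoTermExpansion Real.cos 0 1 (-1 / 2) := by
  refine IsBigO.of_bound (5 / 96) ?_
  filter_upwards [Ioo_mem_nhdsGT one_pos] with t ht
  have h := Real.cos_bound (x := t) (by rw [abs_of_pos ht.1]; exact ht.2.le)
  rw [Real.norm_eq_abs, norm_pow, Real.norm_eq_abs]
  convert h using 1
  · congr 1; ring
  · ring

lemma hasTwoTermExpansion_sin : HasTwoTermExpansion Real.sin 1 1 (-1 / 6) := by
  have h := hasTwoTermExpansion_cos.integral Real.continuous_cos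
  simp only [integral_cos, Real.sin_zero, sub_zero] at h
  convert h using 1 <;> norm_num

lemma hasTwoTermExpansion_one_sub_cos :
    HasTwoTermExpansion (fun t => 1 - Real.cos t) 2 (1 / 2) (-1 / 24) := by
  have h := hasTwoTermExpansion_sin.integral Real.continuous_sin
  simp only [integral_sin, Real.cos_zero] at h
  convert h using 1 <;> norm_num



/-- Expansion of the LLE kernel coefficient `β(r)` on the unit sphere `S^{p-1}` with
regularization order `ρ = 8`, as the geodesic radius `r → 0⁺`. -/
theorem sphere_kernel_coefficient_expansion
    (p : ℕ) (hp : 2 ≤ p) :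
    (fun r : ℝ =>
        (∫ t in (0 : ℝ)..r, (1 - Real.cos t) * Real.sin t ^ (p - 2)) /
            ((∫ t in (0 : ℝ)..r, (1 - Real.cos t) ^ 2 * Real.sin t ^ (p - 2)) +
              r ^ (p + 7)) -
          (2 * ((p : ℝ) + 3) / (((p : ℝ) + 1) * r ^ 2) +
            ((p : ℝ) ^ 2 + 14 * (p : ℝ) - 3) / (6 * ((p : ℝ) + 1) * ((p : ℝ) + 5))))
      =O[𝓝[>] (0 : ℝ)] fun r => r ^ 2 := by
  obtain ⟨n, rfl⟩ := Nat.exists_eq_add_of_le hp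
  rw [Nat.add_sub_cancel_left]
  have hs := hasTwoTermExpansion_sin.pow n
  have hnum := (hasTwoTermExpansion_one_sub_cos.mul hs).integral (by fun_prop)
  have hcos_sq := hasTwoTermExpansion_one_sub_cos.mul hasTwoTermExpansion_one_sub_cos
  simp only [← pow_two] at hcos_sq
  have hden := ((hcos_sq.mul hs).integral (by fun_prop)).add_isBigO
    (g := fun r => r ^ (2 + n + 7)) ((isBigO_refl _ _).congr_left fun r => by ring)
  have hden' : HasTwoTermExpansion _ (2 + n + 1 + 2) _ _ :=
    (show 2 + 2 + n + 1 = 2 + n + 1 + 2 by ring) ▸ hden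
  have h₃ : (n : ℝ) + 3 ≠ 0 := by positivity
  have h₅ : (n : ℝ) + 5 ≠ 0 := by positivity
  have h₇ : (n : ℝ) + 7 ≠ 0 := by positivity
  have e₃ : (2 : ℝ) + n + 1 = n + 3 := by ring
  have e₅ : (2 : ℝ) + n + 3 = n + 5 := by ring
  have e₅' : (4 : ℝ) + n + 1 = n + 5 := by ring
  have e₇ : (2 : ℝ) + n + 5 = n + 7 := by ring
  have e₇' : (4 : ℝ) + n + 3 = n + 7 := by ring
  push_cast at hnum hden' ⊢
  rw [e₃, e₅] at hnum
  rw [e₅', e₇'] at hden'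
  rw [e₃, e₅, e₇]
  refine (hnum.div hden' (u := 2 * (n + 5) / (n + 3))
    (v := ((2 + n) ^ 2 + 14 * (2 + n) - 3) / (6 * (n + 3) * (n + 7))) ?_ ?_ ?_).congr_left ?_
  · positivity
  · field_simp
  · field_simp; ring
  · intro r
    rw [div_div]
end

section
/- Let p ≥ 2 be an integer and, for r > 0, set β(r) := (∫₀^r (1 − cos t)(sin t)^{p−2} dt)/(∫₀^r (1 − cos t)²(sin t)^{p−2} dt + r^{p+7}). Then, as r → 0⁺, ∫₀^r (1 − (1 − cos t)·β(r))·(sin t)^{p−2} dt = (4/((p+1)(p² − 1)))·r^{p−1} + O(r^{p+1}). -/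
open Asymptotics Filter Topology MeasureTheory

theorem isBigO_mul_sub_mul {α : Type*} {l : Filter α} {f g h : α → ℝ} {a b : ℝ}
    (hh : Tendsto h l (𝓝 0)) (hf : (fun x => f x - a) =O[l] h) (hg : (fun x => g x - b) =O[l] h) :
    (fun x => f x * g x - a * b) =O[l] h := by
  have hg0 : Tendsto g l (𝓝 b) := tendsto_sub_nhds_zero_iff.1 (hg.trans_tendsto hh)
  have h1 : (fun x => (f x - a) * g x) =O[l] h := by
    simpa using hf.mul (hg0.isBigO_one ℝ)
  refine (h1.add (hg.const_mul_left a)).congr_left fun x => ?_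
  ring

theorem isBigO_pow_sub_pow {α : Type*} {l : Filter α} {f h : α → ℝ} {a : ℝ}
    (hh : Tendsto h l (𝓝 0)) (hf : (fun x => f x - a) =O[l] h) (n : ℕ) :
    (fun x => f x ^ n - a ^ n) =O[l] h := by
  induction n with
  | zero => simpa using isBigO_zero h l
  | succ n ih => simpa only [pow_succ] using isBigO_mul_sub_mul hh ih hf

theorem isBigO_inv_sub_inv {α : Type*} {l : Filter α} {f h : α → ℝ} {a : ℝ} (ha : a ≠ 0)
    (hh : Tendsto h l (𝓝 0)) (hf : (fun x => f x - a) =O[l] h) :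
    (fun x => (f x)⁻¹ - a⁻¹) =O[l] h := by
  have hf0 : Tendsto f l (𝓝 a) := tendsto_sub_nhds_zero_iff.1 (hf.trans_tendsto hh)
  have h1 : (fun x => (f x - a) * (f x)⁻¹) =O[l] h := by
    simpa using hf.mul ((hf0.inv₀ ha).isBigO_one ℝ)
  refine (h1.const_mul_left (-a⁻¹)).congr' ?_ EventuallyEq.rfl
  filter_upwards [hf0.eventually_ne ha] with x hx
  field_simp
  ring

theorem isBigO_intervalIntegral_pow {f : ℝ → ℝ} {m : ℕ}
    (hf : f =O[𝓝[>] (0 : ℝ)] fun t => t ^ m) :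
    (fun r => ∫ t in (0 : ℝ)..r, f t) =O[𝓝[>] (0 : ℝ)] fun r => r ^ (m + 1) := by
  obtain ⟨C, hC, hfC⟩ := hf.exists_nonneg
  obtain ⟨δ, hδ, hb⟩ := mem_nhdsGT_iff_exists_Ioo_subset.1 hfC.bound
  refine IsBigO.of_bound C ?_
  filter_upwards [Ioo_mem_nhdsGT hδ] with r hr
  have hr0 : 0 < r := hr.1
  have key : ‖∫ t in (0 : ℝ)..r, f t‖ ≤ C * r ^ m * |r - 0| := by
    refine intervalIntegral.norm_integral_le_of_norm_le_const fun t ht => ?_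
    rw [Set.uIoc_of_le hr0.le] at ht
    have h1 : ‖f t‖ ≤ C * ‖t ^ m‖ := hb ⟨ht.1, ht.2.trans_lt hr.2⟩
    rw [Real.norm_of_nonneg (pow_nonneg ht.1.le m)] at h1
    exact h1.trans (mul_le_mul_of_nonneg_left (pow_le_pow_left₀ ht.1.le ht.2 m) hC)
  rw [sub_zero, abs_of_pos hr0] at key
  rw [Real.norm_of_nonneg (pow_nonneg hr0.le _), pow_succ, ← mul_assoc]
  exact key

theorem tendsto_sq_nhdsGT_zero :
    Tendsto (fun t : ℝ => t ^ 2) (𝓝[>] 0) (𝓝 0) := by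
  have h : Tendsto (fun t : ℝ => t ^ 2) (𝓝 0) (𝓝 (0 ^ 2)) := (continuous_pow 2).tendsto 0
  rw [zero_pow two_ne_zero] at h
  exact h.mono_left nhdsWithin_le_nhds

theorem isBigO_sin_div_sub_one :
    (fun t => Real.sin t / t - 1) =O[𝓝[>] (0 : ℝ)] fun t => t ^ 2 := by
  refine IsBigO.of_bound 1 ?_
  filter_upwards [Ioo_mem_nhdsGT (zero_lt_one (α := ℝ))] with t ht
  have h1 := Real.sin_gt_sub_cube ht.1
  have h2 := Real.sin_lt ht.1
  have ht0 := ht.1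
  rw [Real.norm_of_nonneg (sq_nonneg t), Real.norm_eq_abs, div_sub_one ht0.ne', abs_div,
    abs_of_pos ht0, div_le_iff₀ ht0, abs_le]
  have h3 : 0 < t ^ 3 := pow_pos ht0 3
  constructor <;> nlinarith

theorem isBigO_one_sub_cos_div_sq_sub_half :
    (fun t => (1 - Real.cos t) / t ^ 2 - 1 / 2) =O[𝓝[>] (0 : ℝ)] fun t => t ^ 2 := by
  refine IsBigO.of_bound 1 ?_
  filter_upwards [Ioo_mem_nhdsGT (zero_lt_one (α := ℝ))] with t ht
  have ht0 : 0 < t := ht.1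
  have h1 := abs_le.1 (Real.cos_bound (x := t) (by rw [abs_of_pos ht0]; exact ht.2.le))
  rw [abs_of_pos ht0] at h1
  have h2 : 0 < t ^ 2 := pow_pos ht0 2
  have h3 : (1 - Real.cos t) / t ^ 2 - 1 / 2 = (1 - Real.cos t - t ^ 2 / 2) / t ^ 2 := by
    field_simp
  rw [Real.norm_of_nonneg (sq_nonneg t), Real.norm_eq_abs, h3, abs_div,
    abs_of_pos h2, div_le_iff₀ h2, abs_le]
  have h4 : 0 < t ^ 4 := pow_pos ht0 4
  constructor <;> nlinarith

/-- The radial moment `∫₀^r (1 - cos t)^k (sin t)^n dt`, normalized by its leading power of `r`,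
has relative error of order `r²`. -/
theorem isBigO_integral_one_sub_cos_pow_mul_sin_pow (k n : ℕ) :
    (fun r : ℝ => (∫ t in (0 : ℝ)..r, (1 - Real.cos t) ^ k * Real.sin t ^ n) /
        r ^ (2 * k + n + 1) - (1 / 2) ^ k / ((2 * k + n : ℕ) + 1 : ℝ))
      =O[𝓝[>] (0 : ℝ)] fun r => r ^ 2 := by
  have h1 := isBigO_mul_sub_mul tendsto_sq_nhdsGT_zero
    (isBigO_pow_sub_pow tendsto_sq_nhdsGT_zero isBigO_one_sub_cos_div_sq_sub_half k)
    (isBigO_pow_sub_pow tendsto_sq_nhdsGT_zero isBigO_sin_div_sub_one n)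
  have h2 : (fun t => (1 - Real.cos t) ^ k * Real.sin t ^ n - (1 / 2) ^ k * t ^ (2 * k + n))
      =O[𝓝[>] (0 : ℝ)] fun t => t ^ (2 * k + n + 2) := by
    refine ((isBigO_refl (fun t : ℝ => t ^ (2 * k + n)) _).mul h1).congr' ?_
      (Eventually.of_forall fun t => (pow_add t _ _).symm)
    filter_upwards [self_mem_nhdsWithin] with t ht
    have ht0 : t ≠ 0 := ne_of_gt ht
    rw [div_pow, div_pow, one_pow, ← pow_mul, pow_add]
    field_simp
  have h3 := isBigO_intervalIntegral_pow h2
  refine (h3.mul (isBigO_refl (fun r : ℝ => (r ^ (2 * k + n + 1))⁻¹) _)).congr' ?_ ?_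
  · filter_upwards [self_mem_nhdsWithin] with r hr
    have hr0 : r ≠ 0 := ne_of_gt hr
    rw [intervalIntegral.integral_sub
      (Continuous.intervalIntegrable (by fun_prop) _ _)
      (Continuous.intervalIntegrable (by fun_prop) _ _),
      intervalIntegral.integral_const_mul, integral_pow, zero_pow (Nat.succ_ne_zero _), sub_zero]
    field_simp
  · filter_upwards [self_mem_nhdsWithin] with r hr
    have hr0 : r ≠ 0 := ne_of_gt hr
    field_simp
    ring

/-- Radial integral of the LLE kernel on `S^{p-1}` with regularization order `ρ = 8`:
`∫₀^r (1 − (1 − cos t)β(r))(sin t)^{p−2} dt = (4/((p+1)(p²−1))) r^{p−1} + O(r^{p+1})`. -/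
theorem sphere_kernel_integral_expansion
    (p : ℕ) (hp : 2 ≤ p) (β : ℝ → ℝ)
    (hβ : ∀ r, β r =
      (∫ t in (0 : ℝ)..r, (1 - Real.cos t) * Real.sin t ^ (p - 2)) /
        ((∫ t in (0 : ℝ)..r, (1 - Real.cos t) ^ 2 * Real.sin t ^ (p - 2)) + r ^ (p + 7))) :
    (fun r : ℝ =>
        (∫ t in (0 : ℝ)..r, (1 - (1 - Real.cos t) * β r) * Real.sin t ^ (p - 2)) -
          (4 / (((p : ℝ) + 1) * ((p : ℝ) ^ 2 - 1))) * r ^ (p - 1))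
      =O[𝓝[>] (0 : ℝ)] fun r => r ^ (p + 1) := by
  obtain ⟨n, rfl⟩ := Nat.exists_eq_add_of_le' hp
  have hsq := tendsto_sq_nhdsGT_zero
  have hA := isBigO_integral_one_sub_cos_pow_mul_sin_pow 0 n
  have hB := isBigO_integral_one_sub_cos_pow_mul_sin_pow 1 n
  have hD := isBigO_integral_one_sub_cos_pow_mul_sin_pow 2 n
  simp only [pow_zero, one_mul, pow_one] at hA hB
  have hr4 : (fun r : ℝ => r ^ 4) =O[𝓝[>] (0 : ℝ)] fun r => r ^ 2 := by
    have h := (hsq.isBigO_one ℝ).mul (isBigO_refl (fun r : ℝ => r ^ 2) (𝓝[>] 0))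
    refine h.congr (fun r => ?_) (fun r => one_mul _)
    ring
  have hE := (hD.add hr4).congr_left (fun r => add_sub_right_comm _ _ _ |>.symm)
  have hQ := isBigO_mul_sub_mul hsq (isBigO_pow_sub_pow hsq hB 2)
    (isBigO_inv_sub_inv (by positivity) hsq hE)
  refine ((isBigO_refl (fun r : ℝ => r ^ (n + 1)) _).mul (hA.sub hQ)).congr' ?_
    (Eventually.of_forall fun r => by ring)
  filter_upwards [self_mem_nhdsWithin] with r hr
  have hr0 : r ≠ 0 := ne_of_gt hr
  have hsplit : (∫ t in (0 : ℝ)..r, (1 - (1 - Real.cos t) * β r) * Real.sin t ^ n) =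
      (∫ t in (0 : ℝ)..r, Real.sin t ^ n) -
        β r * ∫ t in (0 : ℝ)..r, (1 - Real.cos t) * Real.sin t ^ n := by
    rw [← intervalIntegral.integral_const_mul, ← intervalIntegral.integral_sub
      (Continuous.intervalIntegrable (by fun_prop) _ _)
      (Continuous.intervalIntegrable (by fun_prop) _ _)]
    congr 1 with t
    ring
  simp only [Nat.add_sub_cancel, show n + 2 - 1 = n + 1 from rfl] at hβ ⊢
  rw [hsplit, hβ]
  generalize (∫ t in (0 : ℝ)..r, Real.sin t ^ n) = A
  generalize (∫ t in (0 : ℝ)..r, (1 - Real.cos t) * Real.sin t ^ n) = B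
  generalize (∫ t in (0 : ℝ)..r, (1 - Real.cos t) ^ 2 * Real.sin t ^ n) = D
  have hden : D / r ^ (2 * 2 + n + 1) + r ^ 4 = (D + r ^ (n + 2 + 7)) / r ^ (n + 5) := by
    field_simp
    ring
  have hconst : (4 / ((((n + 2 : ℕ) : ℝ) + 1) * (((n + 2 : ℕ) : ℝ) ^ 2 - 1))) =
      1 / ((2 * 0 + n : ℕ) + 1 : ℝ) - (((1 / 2) / ((2 * 1 + n : ℕ) + 1 : ℝ)) ^ 2 *
        ((1 / 2) ^ 2 / ((2 * 2 + n : ℕ) + 1 : ℝ))⁻¹) := by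
    have h1 : ((n : ℝ) + 2) ^ 2 - 1 = (n + 1) * (n + 3) := by ring
    have h2 : (n : ℝ) + 1 ≠ 0 := by positivity
    have h3 : (n : ℝ) + 3 ≠ 0 := by positivity
    have h5 : (n : ℝ) + 5 ≠ 0 := by positivity
    push_cast
    rw [h1, show (n : ℝ) + 2 + 1 = n + 3 by ring, show 0 + (n : ℝ) + 1 = n + 1 by ring,
      show 2 + (n : ℝ) + 1 = n + 3 by ring, show 4 + (n : ℝ) + 1 = n + 5 by ring]
    field_simp
    ring
  have hmain : r ^ (n + 1) * (A / r ^ (2 * 0 + n + 1) - (B / r ^ (2 * 1 + n + 1)) ^ 2 *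
      ((D + r ^ (n + 2 + 7)) / r ^ (n + 5))⁻¹) = A - B / (D + r ^ (n + 2 + 7)) * B := by
    generalize D + r ^ (n + 2 + 7) = E
    rw [inv_div, mul_sub, show 2 * 0 + n + 1 = n + 1 by ring, mul_div_cancel₀ _ (pow_ne_zero _ hr0)]
    have : r ^ (n + 1) * r ^ (n + 5) = (r ^ (2 * 1 + n + 1)) ^ 2 := by ring
    rw [div_pow, ← this]
    field_simp
  rw [hden, hconst, ← hmain]
  ring
end

section
/- Let f : ℝ → ℝ be smooth. For 0 < ε < 2 set r(ε) := 2·arcsin(ε/2), β(ε) := (∫₀^{r(ε)} (1 − cos t) dt)/(∫₀^{r(ε)} (1 − cos t)² dt + ε⁹), and K_ε(t) := 1 − (1 − cos t)·β(ε). Then, as ε → 0⁺, (∫_{−r(ε)}^{r(ε)} K_ε(t)·f(t) dt)/(∫_{−r(ε)}^{r(ε)} K_ε(t) dt) − f(0) = −(1/280)·(f''''(0) + f''(0))·ε⁴ + O(ε⁶). -/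
open Asymptotics Filter Topology MeasureTheory

section

open Set intervalIntegral

/-- `X ε = c * ε ^ n + O(ε ^ (n + 2))` as `ε → 0⁺`. -/
def HasLeadingTerm (X : ℝ → ℝ) (c : ℝ) (n : ℕ) : Prop :=
  (fun ε => X ε - c * ε ^ n) =O[𝓝[>] (0 : ℝ)] fun ε => ε ^ (n + 2)

lemma isBigO_pow_pow_nhdsGT_zero {m n : ℕ} (h : m ≤ n) :
    (fun ε : ℝ => ε ^ n) =O[𝓝[>] (0 : ℝ)] fun ε => ε ^ m := by
  refine IsBigO.of_bound 1 ?_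
  filter_upwards [Ioo_mem_nhdsGT (zero_lt_one' ℝ)] with x hx
  rw [one_mul, norm_pow, norm_pow, Real.norm_of_nonneg hx.1.le]
  exact pow_le_pow_of_le_one hx.1.le hx.2.le h

namespace HasLeadingTerm

variable {X Y : ℝ → ℝ} {c d : ℝ} {m n : ℕ}

lemma of_isBigO (h : X =O[𝓝[>] (0 : ℝ)] fun ε => ε ^ (n + 2)) : HasLeadingTerm X 0 n := by
  simpa [HasLeadingTerm] using h

lemma monomial (c : ℝ) (n : ℕ) : HasLeadingTerm (fun ε => c * ε ^ n) c n := by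
  simp [HasLeadingTerm, Asymptotics.isBigO_zero]

lemma isBigO (h : HasLeadingTerm X c n) : X =O[𝓝[>] (0 : ℝ)] fun ε => ε ^ n := by
  have h1 := IsBigO.trans h (isBigO_pow_pow_nhdsGT_zero (Nat.le_add_right n 2))
  simpa using h1.add ((isBigO_refl (fun ε : ℝ => ε ^ n) _).const_mul_left c)

lemma of_le (h : HasLeadingTerm X c n) (hmn : m + 2 ≤ n) : HasLeadingTerm X 0 m :=
  of_isBigO (h.isBigO.trans (isBigO_pow_pow_nhdsGT_zero hmn))

lemma add (hX : HasLeadingTerm X c n) (hY : HasLeadingTerm Y d n) :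
    HasLeadingTerm (fun ε => X ε + Y ε) (c + d) n :=
  (IsBigO.add hX hY).congr_left fun ε => by ring

lemma sub (hX : HasLeadingTerm X c n) (hY : HasLeadingTerm Y d n) :
    HasLeadingTerm (fun ε => X ε - Y ε) (c - d) n :=
  (IsBigO.sub hX hY).congr_left fun ε => by ring

lemma const_mul (a : ℝ) (hX : HasLeadingTerm X c n) :
    HasLeadingTerm (fun ε => a * X ε) (a * c) n :=
  (IsBigO.const_mul_left hX a).congr_left fun ε => by ring

lemma mul (hX : HasLeadingTerm X c m) (hY : HasLeadingTerm Y d n) :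
    HasLeadingTerm (fun ε => X ε * Y ε) (c * d) (m + n) := by
  have h1 := IsBigO.mul hX hY.isBigO
  have h2 := (IsBigO.mul (isBigO_refl (fun ε : ℝ => ε ^ m) (𝓝[>] 0)) hY).const_mul_left c
  have h1' := h1.congr_right (g₂ := fun ε : ℝ => ε ^ (m + n + 2)) fun ε => by ring
  have h2' := h2.congr_right (g₂ := fun ε : ℝ => ε ^ (m + n + 2)) fun ε => by ring
  exact (h1'.add h2').congr_left fun ε => by ring

lemma pow (hX : HasLeadingTerm X c m) (k : ℕ) :
    HasLeadingTerm (fun ε => X ε ^ k) (c ^ k) (k * m) := by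
  induction k with
  | zero => simpa using monomial 1 0
  | succ k ih => simpa only [pow_succ, Nat.succ_mul] using ih.mul hX

lemma isTheta (hX : HasLeadingTerm X c n) (hc : c ≠ 0) :
    X =Θ[𝓝[>] (0 : ℝ)] fun ε => ε ^ n := by
  have hlt : (fun ε : ℝ => ε ^ (n + 2)) =o[𝓝[>] (0 : ℝ)] fun ε => ε ^ n :=
    (isLittleO_pow_pow (by omega : n < n + 2)).mono nhdsWithin_le_nhds
  have hequiv : X ~[𝓝[>] (0 : ℝ)] fun ε => c * ε ^ n :=
    (IsBigO.trans_isLittleO hX hlt).trans_isBigO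
      ((isBigO_refl (fun ε : ℝ => ε ^ n) _).const_mul_right hc)
  exact hequiv.isTheta.trans ((isTheta_refl _ _).const_mul_left hc)

lemma eventually_ne_zero (hX : HasLeadingTerm X c n) (hc : c ≠ 0) :
    ∀ᶠ ε in 𝓝[>] (0 : ℝ), X ε ≠ 0 := by
  filter_upwards [(hX.isTheta hc).eq_zero_iff, self_mem_nhdsWithin] with ε h hε h0
  exact pow_ne_zero n (ne_of_gt hε) (h.1 h0)

lemma div (hX : HasLeadingTerm X c (m + n)) (hY : HasLeadingTerm Y d n) (hd : d ≠ 0) :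
    HasLeadingTerm (fun ε => X ε / Y ε) (c / d) m := by
  have h1 : HasLeadingTerm (fun ε => X ε - c / d * ε ^ m * Y ε) 0 (m + n) := by
    simpa [div_mul_cancel₀ c hd] using hX.sub ((monomial (c / d) m).mul hY)
  have h2 := IsBigO.mul h1 (hY.isTheta hd).inv.1
  refine h2.congr' ?_ ?_
  · filter_upwards [hY.eventually_ne_zero hd] with ε h
    field_simp
    ring
  · filter_upwards [self_mem_nhdsWithin] with ε hε
    have : ε ≠ 0 := ne_of_gt hε
    field_simp
    ring

lemma integral {g r : ℝ → ℝ} (hg : Continuous g) (h : HasLeadingTerm g c n)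
    (hr : HasLeadingTerm r 1 1) (hr0 : Tendsto r (𝓝[>] 0) (𝓝[>] 0)) :
    HasLeadingTerm (fun ε => ∫ t in (0 : ℝ)..r ε, g t) (c / (n + 1)) (n + 1) := by
  have hF : (fun x => ∫ t in (0 : ℝ)..x, (g t - c * t ^ n)) =O[𝓝[>] (0 : ℝ)]
      fun x => x ^ (n + 1 + 2) := by
    obtain ⟨C, hC⟩ := IsBigO.bound h
    obtain ⟨δ, hδ, hsub⟩ := mem_nhdsGT_iff_exists_Ioo_subset.1 hC
    have hC0 : 0 ≤ C := by
      have hmem : δ / 2 ∈ Ioo 0 δ := ⟨half_pos hδ, half_lt_self hδ⟩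
      have h1 := (norm_nonneg _).trans (hsub hmem)
      exact nonneg_of_mul_nonneg_left h1 (norm_pos_iff.2 (pow_ne_zero _ (half_pos hδ).ne'))
    refine IsBigO.of_bound C ?_
    filter_upwards [Ioo_mem_nhdsGT hδ] with x hx
    have hb := norm_integral_le_of_norm_le_const (a := 0) (b := x) (C := C * x ^ (n + 2))
      (f := fun t => g t - c * t ^ n) (fun t ht => by
        rw [uIoc_of_le hx.1.le] at ht
        refine (hsub (⟨ht.1, ht.2.trans_lt hx.2⟩ : t ∈ Ioo 0 δ)).trans ?_
        rw [norm_pow, Real.norm_of_nonneg ht.1.le]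
        gcongr
        · exact ht.1.le
        · exact ht.2)
    refine hb.trans_eq ?_
    rw [norm_pow, Real.norm_of_nonneg hx.1.le, sub_zero, abs_of_pos hx.1]
    ring
  have h1 : (fun ε => ∫ t in (0 : ℝ)..r ε, (g t - c * t ^ n)) =O[𝓝[>] (0 : ℝ)]
      fun ε => ε ^ (n + 1 + 2) :=
    (hF.comp_tendsto hr0).trans (by simpa [Function.comp_def] using hr.isBigO.pow (n + 1 + 2))
  have h2 : HasLeadingTerm (fun ε => c / (n + 1) * r ε ^ (n + 1)) (c / (n + 1)) (n + 1) := by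
    simpa using (hr.pow (n + 1)).const_mul (c / (n + 1))
  refine (h1.add h2).congr_left fun ε => ?_
  rw [intervalIntegral.integral_sub (hg.intervalIntegrable _ _)
    ((by fun_prop : Continuous fun t : ℝ => c * t ^ n).intervalIntegrable _ _),
    intervalIntegral.integral_const_mul, integral_pow]
  simp only [ne_eq, Nat.add_eq_zero_iff, one_ne_zero, and_false, not_false_eq_true, zero_pow]
  ring

end HasLeadingTerm

lemma hasLeadingTerm_one_sub_cos : HasLeadingTerm (fun t => 1 - Real.cos t) (1 / 2) 2 := by
  refine IsBigO.of_bound (5 / 96) ?_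
  filter_upwards [Ioo_mem_nhdsGT (zero_lt_one' ℝ)] with x hx
  have h := Real.cos_bound (abs_le.2 ⟨by linarith [hx.1], hx.2.le⟩)
  rw [Real.norm_eq_abs, norm_pow, Real.norm_eq_abs]
  refine le_of_eq_of_le ?_ (h.trans_eq (mul_comm _ _))
  rw [← abs_neg]
  ring_nf

lemma hasLeadingTerm_two_mul_arcsin_half :
    HasLeadingTerm (fun ε => 2 * Real.arcsin (ε / 2)) 1 1 := by
  have hd : HasDerivAt (fun ε : ℝ => Real.arcsin (ε / 2)) (1 / √(1 - (0 / 2) ^ 2) * (1 / 2)) 0 :=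
    (Real.hasDerivAt_arcsin (by norm_num) (by norm_num)).comp (0 : ℝ)
      ((hasDerivAt_id (0 : ℝ)).div_const 2)
  have hO : (fun ε : ℝ => Real.arcsin (ε / 2)) =O[𝓝 (0 : ℝ)] fun ε => ε := by
    simpa using hd.isBigO_sub
  have ht : Tendsto (fun ε : ℝ => Real.arcsin (ε / 2)) (𝓝 0) (𝓝 0) := by
    simpa using hd.continuousAt.tendsto
  have hs : (fun y : ℝ => y - Real.sin y) =O[𝓝 (0 : ℝ)] fun y => y ^ 3 := by
    refine IsBigO.of_bound 1 ?_
    filter_upwards [Metric.closedBall_mem_nhds (0 : ℝ) one_pos] with y hy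
    have hy : |y| ≤ 1 := by simpa using hy
    have h := Real.sin_bound hy
    have h5 : |y| ^ 5 ≤ |y| ^ 3 := pow_le_pow_of_le_one (abs_nonneg y) hy (by norm_num)
    rw [Real.norm_eq_abs, norm_pow, Real.norm_eq_abs, one_mul]
    have h3 : |y ^ 3 / 6| = |y| ^ 3 / 6 := by rw [abs_div, abs_pow]; norm_num
    calc |y - Real.sin y| = |y ^ 3 / 6 - (Real.sin y - (y - y ^ 3 / 6))| := by ring_nf
      _ ≤ |y ^ 3 / 6| + |Real.sin y - (y - y ^ 3 / 6)| := abs_sub _ _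
      _ ≤ |y| ^ 3 := by rw [h3]; linarith [pow_nonneg (abs_nonneg y) 3]
  have h := (((hs.comp_tendsto ht).trans (hO.pow 3)).const_mul_left 2).mono
    (nhdsWithin_le_nhds (s := Ioi 0))
  refine h.congr' ?_ .rfl
  filter_upwards [Ioo_mem_nhdsGT (zero_lt_one' ℝ)] with x hx
  simp only [Function.comp_apply]
  rw [Real.sin_arcsin (by linarith [hx.1]) (by linarith [hx.2])]
  ring

lemma tendsto_two_mul_arcsin_half_nhdsGT :
    Tendsto (fun ε : ℝ => 2 * Real.arcsin (ε / 2)) (𝓝[>] 0) (𝓝[>] 0) := by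
  refine tendsto_nhdsWithin_iff.2 ⟨?_, ?_⟩
  · have h : Continuous fun ε : ℝ => 2 * Real.arcsin (ε / 2) :=
      (Real.continuous_arcsin.comp (continuous_id.div_const 2)).const_mul 2
    simpa using (h.tendsto 0).mono_left nhdsWithin_le_nhds
  · filter_upwards [self_mem_nhdsWithin] with ε hε
    exact mul_pos two_pos (Real.arcsin_pos.2 (half_pos hε))

lemma isBigO_even_part_sub_taylor {f : ℝ → ℝ} (hf : ContDiff ℝ 6 f) :
    (fun t => f t + f (-t) - 2 * f 0 - iteratedDeriv 2 f 0 * t ^ 2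
      - iteratedDeriv 4 f 0 / 12 * t ^ 4) =O[𝓝[>] (0 : ℝ)] fun t => t ^ 6 := by
  have h := (taylor_isLittleO_univ (x₀ := 0) (n := 6) (mod_cast hf)).isBigO
  have hneg : Tendsto (fun t : ℝ => -t) (𝓝 0) (𝓝 0) := by
    simpa using (continuous_neg (G := ℝ)).tendsto 0
  have h' := (h.comp_tendsto hneg).congr_right (g₂ := fun t : ℝ => (t - 0) ^ 6) fun t => by
    simp [(by decide : Even 6).neg_pow]
  have h6 := (isBigO_refl (fun t : ℝ => (t - 0) ^ 6) (𝓝 0)).const_mul_left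
    (iteratedDeriv 6 f 0 / 360)
  have hsum := ((h.add h').add h6).mono (nhdsWithin_le_nhds (s := Ioi 0))
  refine hsum.congr (fun t => ?_) (fun t => by simp)
  simp only [taylor_within_apply, Finset.sum_range_succ, Finset.sum_range_zero,
    iteratedDerivWithin_univ, Function.comp_apply, iteratedDeriv_zero, smul_eq_mul, sub_zero]
  norm_num [Nat.factorial]
  ring

lemma integral_symm_eq_integral_add_comp_neg {g : ℝ → ℝ} (hg : Continuous g) (a : ℝ) :
    ∫ t in (-a)..a, g t = ∫ t in (0 : ℝ)..a, (g t + g (-t)) := by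
  have hg' : Continuous fun t => g (-t) := hg.comp continuous_neg
  rw [← integral_add_adjacent_intervals (hg.intervalIntegrable (-a) 0) (hg.intervalIntegrable 0 a),
    intervalIntegral.integral_add (hg.intervalIntegrable _ _) (hg'.intervalIntegrable _ _),
    intervalIntegral.integral_comp_neg, neg_zero, add_comm]

end

/-- Formula (4.2): on the unit circle `S¹` with uniform sampling and regularization order
`ρ = 8`, the LLE integral operator satisfies
`Qf(x) − f(x) = −(1/280)(f'''' + f'')ε⁴ + O(ε⁶)`. -/
theorem circle_lle_fourth_order
    (f : ℝ → ℝ) (hf : ContDiff ℝ (⊤ : ℕ∞) f)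
    (r β : ℝ → ℝ) (K : ℝ → ℝ → ℝ)
    (hr : ∀ ε, r ε = 2 * Real.arcsin (ε / 2))
    (hβ : ∀ ε, β ε =
      (∫ t in (0 : ℝ)..(r ε), (1 - Real.cos t)) /
        ((∫ t in (0 : ℝ)..(r ε), (1 - Real.cos t) ^ 2) + ε ^ 9))
    (hK : ∀ ε t, K ε t = 1 - (1 - Real.cos t) * β ε) :
    (fun ε =>
        ((∫ t in (-(r ε))..(r ε), K ε t * f t) / (∫ t in (-(r ε))..(r ε), K ε t) - f 0) -
          (-(1 / 280) * (iteratedDeriv 4 f 0 + iteratedDeriv 2 f 0) * ε ^ 4))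
      =O[𝓝[>] (0 : ℝ)] fun ε => ε ^ 6 := by
  obtain rfl : r = fun ε => 2 * Real.arcsin (ε / 2) := funext hr
  set r : ℝ → ℝ := fun ε => 2 * Real.arcsin (ε / 2)
  have hr1 : HasLeadingTerm r 1 1 := hasLeadingTerm_two_mul_arcsin_half
  have hr0 : Tendsto r (𝓝[>] 0) (𝓝[>] 0) := tendsto_two_mul_arcsin_half_nhdsGT
  have hfc : Continuous f := hf.continuous
  set f₂ := iteratedDeriv 2 f 0
  set f₄ := iteratedDeriv 4 f 0
  set a : ℝ → ℝ := fun t => 1 - Real.cos t with ha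
  have hac : Continuous a := by fun_prop
  have ha2 : HasLeadingTerm a (1 / 2) 2 := hasLeadingTerm_one_sub_cos
  set h : ℝ → ℝ := fun t => f t + f (-t) - 2 * f 0 with hh
  have hhc : Continuous h := by fun_prop
  set ρ : ℝ → ℝ := fun t => h t - 2 * f₂ * a t - (f₄ + f₂) / 12 * t ^ 4 with hρ
  have hρc : Continuous ρ := by fun_prop
  have hρ0 : HasLeadingTerm ρ 0 4 := by
    refine HasLeadingTerm.of_isBigO ?_
    have h1 := isBigO_even_part_sub_taylor (f := f) (contDiff_infty.1 hf 6)
    have h2 := (isBigO_even_part_sub_taylor (f := Real.cos) Real.contDiff_cos).const_mul_left f₂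
    have hcos2 : iteratedDeriv 2 Real.cos 0 = -1 := by
      simp
    have hcos4 : iteratedDeriv 4 Real.cos 0 = 1 := by
      simp
    refine (h1.add h2).congr_left fun t => ?_
    simp only [hcos2, hcos4, Real.cos_neg, Real.cos_zero, hρ, hh, ha]
    ring
  set A₁ : ℝ → ℝ := fun ε => ∫ t in (0 : ℝ)..r ε, a t with hA₁
  set A₂ : ℝ → ℝ := fun ε => ∫ t in (0 : ℝ)..r ε, a t ^ 2 with hA₂
  set M : ℝ → ℝ := fun ε => ∫ t in (0 : ℝ)..r ε, a t * t ^ 4 with hM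
  set P : ℝ → ℝ := fun ε => ∫ t in (0 : ℝ)..r ε, ρ t with hP
  set Q : ℝ → ℝ := fun ε => ∫ t in (0 : ℝ)..r ε, a t * ρ t with hQ
  have hA₁l : HasLeadingTerm A₁ (1 / 6) 3 := by
    convert HasLeadingTerm.integral hac ha2 hr1 hr0 using 1
    norm_num
  have hA₂l : HasLeadingTerm A₂ (1 / 20) 5 := by
    convert HasLeadingTerm.integral (g := fun t => a t ^ 2) (by fun_prop) (ha2.pow 2) hr1 hr0
      using 1
    norm_num
  have hMl : HasLeadingTerm M (1 / 14) 7 := by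
    have h4 : HasLeadingTerm (fun t => t ^ 4) 1 4 := by simpa using HasLeadingTerm.monomial 1 4
    convert HasLeadingTerm.integral (by fun_prop) (ha2.mul h4) hr1 hr0 using 1
    norm_num
  have hPl : HasLeadingTerm P 0 5 := by
    simpa using HasLeadingTerm.integral hρc hρ0 hr1 hr0
  have hQl : HasLeadingTerm Q 0 7 := by
    simpa using HasLeadingTerm.integral (by fun_prop) (ha2.mul hρ0) hr1 hr0
  have h9 : HasLeadingTerm (fun ε => ε ^ 9) 1 9 := by
    simpa using HasLeadingTerm.monomial 1 9
  set B : ℝ → ℝ := fun ε => A₂ ε + ε ^ 9 with hB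
  have hBl : HasLeadingTerm B (1 / 20) 5 := by
    simpa using hA₂l.add (h9.of_le (m := 5) (by norm_num))
  have hD : HasLeadingTerm (fun ε => 2 * (r ε * B ε - A₁ ε * A₁ ε)) (2 / 45) 6 := by
    convert ((hr1.mul hBl).sub (hA₁l.mul hA₁l)).const_mul 2 using 1
    norm_num
  have hN : HasLeadingTerm (fun ε => 2 * f₂ * (A₁ ε * ε ^ 9)
      + (f₄ + f₂) / 12 * (1 / 5 * (B ε * r ε ^ 5) - A₁ ε * M ε)
      + (B ε * P ε - A₁ ε * Q ε)) (-(f₄ + f₂) / 6300) 10 := by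
    have t1 := ((hA₁l.mul h9).of_le (m := 10) (by norm_num)).const_mul (2 * f₂)
    have t2 := (((hBl.mul (hr1.pow 5)).const_mul (1 / 5)).sub (hA₁l.mul hMl)).const_mul
      ((f₄ + f₂) / 12)
    have t3 := (hBl.mul hPl).sub (hA₁l.mul hQl)
    convert (t1.add t2).add t3 using 1
    ring
  have hfinal := HasLeadingTerm.div (m := 4) hN hD (by norm_num)
  refine IsBigO.congr' hfinal ?_ .rfl
  filter_upwards [hD.eventually_ne_zero (by norm_num), hBl.eventually_ne_zero (by norm_num)]
    with ε hDε hBε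
  have hβ' : β ε = A₁ ε / B ε := hβ ε
  have hKeq : K ε = fun t => 1 - a t * β ε := funext (hK ε)
  have hKc : Continuous (K ε) := by rw [hKeq]; fun_prop
  have hlin : ∀ {u v : ℝ → ℝ}, Continuous u → Continuous v →
      ∫ t in (0 : ℝ)..r ε, (u t - v t * β ε) =
        (∫ t in (0 : ℝ)..r ε, u t) - (∫ t in (0 : ℝ)..r ε, v t) * β ε := fun hu hv => by
    rw [intervalIntegral.integral_sub (hu.intervalIntegrable _ _)
      ((hv.mul_const _).intervalIntegrable _ _), intervalIntegral.integral_mul_const]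
  have hden : ∫ t in (-(r ε))..(r ε), K ε t = 2 * (r ε - A₁ ε * β ε) := by
    have hpt : ∀ t, K ε t + K ε (-t) = 2 * (1 - a t * β ε) := fun t => by
      simp only [hKeq, ha, Real.cos_neg]
      ring
    rw [integral_symm_eq_integral_add_comp_neg hKc]
    simp only [hpt]
    rw [intervalIntegral.integral_const_mul, hlin continuous_const hac]
    simp [hA₁]
  have hnum : (∫ t in (-(r ε))..(r ε), K ε t * f t) - f 0 * ∫ t in (-(r ε))..(r ε), K ε t =
      2 * f₂ * (A₁ ε - A₂ ε * β ε) + (f₄ + f₂) / 12 * (r ε ^ 5 / 5 - M ε * β ε)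
        + (P ε - Q ε * β ε) := by
    have hpt : ∀ t, (K ε t * f t - f 0 * K ε t) + (K ε (-t) * f (-t) - f 0 * K ε (-t)) =
        2 * f₂ * (a t - a t ^ 2 * β ε) + (f₄ + f₂) / 12 * (t ^ 4 - a t * t ^ 4 * β ε)
          + (ρ t - a t * ρ t * β ε) := fun t => by
      simp only [hKeq, hρ, hh, ha, Real.cos_neg]
      ring
    have c₁ : Continuous fun t => 2 * f₂ * (a t - a t ^ 2 * β ε) := by fun_prop
    have c₂ : Continuous fun t => (f₄ + f₂) / 12 * (t ^ 4 - a t * t ^ 4 * β ε) := by fun_prop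
    have c₁₂ : Continuous fun t => 2 * f₂ * (a t - a t ^ 2 * β ε)
        + (f₄ + f₂) / 12 * (t ^ 4 - a t * t ^ 4 * β ε) := c₁.add c₂
    have c₃ : Continuous fun t => ρ t - a t * ρ t * β ε := by fun_prop
    have hKf : Continuous fun t => K ε t * f t := hKc.mul hfc
    rw [← intervalIntegral.integral_const_mul, ← intervalIntegral.integral_sub
      (hKf.intervalIntegrable _ _) ((hKc.const_mul _).intervalIntegrable _ _),
      integral_symm_eq_integral_add_comp_neg (by fun_prop)]
    simp only [hpt]
    rw [intervalIntegral.integral_add (c₁₂.intervalIntegrable _ _)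
        (c₃.intervalIntegrable _ _),
      intervalIntegral.integral_add (c₁.intervalIntegrable _ _) (c₂.intervalIntegrable _ _),
      intervalIntegral.integral_const_mul, intervalIntegral.integral_const_mul,
      hlin (v := fun t => a t ^ 2) hac (by fun_prop),
      hlin (u := fun t => t ^ 4) (v := fun t => a t * t ^ 4) (by fun_prop) (by fun_prop),
      hlin (v := fun t => a t * ρ t) hρc (by fun_prop), integral_pow]
    norm_num [hA₁, hA₂, hM, hP, hQ]
  have hden0 : r ε - A₁ ε * β ε ≠ 0 := by
    intro h0
    apply hDε
    rw [hβ'] at h0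
    field_simp at h0
    linear_combination 2 * h0
  have hquot : (∫ t in (-(r ε))..(r ε), K ε t * f t) / (∫ t in (-(r ε))..(r ε), K ε t) - f 0 =
      (2 * f₂ * (A₁ ε - A₂ ε * β ε) + (f₄ + f₂) / 12 * (r ε ^ 5 / 5 - M ε * β ε)
        + (P ε - Q ε * β ε)) / (2 * (r ε - A₁ ε * β ε)) := by
    rw [← hnum, ← hden, sub_div, mul_div_cancel_right₀]
    rw [hden]
    exact mul_ne_zero two_ne_zero hden0
  rw [hquot]
  congr 1
  · rw [div_eq_div_iff hDε (mul_ne_zero two_ne_zero hden0), hβ']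
    have hA₂B : A₂ ε = B ε - ε ^ 9 := by simp [hB]
    rw [hA₂B]
    field_simp
    ring
  · ring
end

section
/- Let 0 < d < p be integers and λ ≠ 0 a real number. Let A, X, Λ : ℝ → ℝ^{p×p} be matrix-valued functions, differentiable at 0, such that for all ε in a neighborhood of 0: A(ε)·X(ε) = X(ε)·Λ(ε) and Λ(ε) is a diagonal matrix. Assume A(0) = Λ(0) is the block-diagonal matrix with (1,1)-block λ·I_d and all other blocks zero, and X(0) is block diagonal with blocks X₁ ∈ ℝ^{d×d} and X₂ ∈ ℝ^{(p−d)×(p−d)} satisfying X₁ᵀX₁ = I_d and X₂ᵀX₂ = I_{p−d}. Write A'(0) in 2×2 block form with blocks A'₁₁ ∈ ℝ^{d×d}, A'₁₂ ∈ ℝ^{d×(p−d)}, A'₂₁, A'₂₂; write Λ'(0) block-diagonal as diag(Λ'₁, Λ'₂); and set C := X(0)ᵀ·X'(0) with blocks C₁₁, C₁₂, C₂₁, C₂₂. Then: A'₁₁·X₁ = X₁·Λ'₁; A'₂₂·X₂ = X₂·Λ'₂; C₁₂ = −λ⁻¹·X₁ᵀ·A'₁₂·X₂; and C₂₁ = λ⁻¹·X₂ᵀ·A'₂₁·X₁.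 -/
open Matrix Filter Topology

/-- The entrywise derivative of a matrix-valued function. -/
noncomputable def entryDeriv {m n : Type*} (M : ℝ → Matrix m n ℝ) (t : ℝ) : Matrix m n ℝ :=
  Matrix.of fun i j => deriv (fun ε => M ε i j) t

theorem entryDeriv_congr {m n : Type*} {M N : ℝ → Matrix m n ℝ} {t : ℝ} (h : M =ᶠ[𝓝 t] N) :
    entryDeriv M t = entryDeriv N t := by
  ext i j
  exact Filter.EventuallyEq.deriv_eq (h.mono fun ε hε => congrFun (congrFun hε i) j)

theorem entryDeriv_mul {l m n : Type*} [Fintype m] {M : ℝ → Matrix l m ℝ} {N : ℝ → Matrix m n ℝ}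
    {t : ℝ} (hM : ∀ i j, DifferentiableAt ℝ (fun ε => M ε i j) t)
    (hN : ∀ i j, DifferentiableAt ℝ (fun ε => N ε i j) t) :
    entryDeriv (fun ε => M ε * N ε) t = entryDeriv M t * N t + M t * entryDeriv N t := by
  ext i j
  simp only [entryDeriv, Matrix.of_apply, Matrix.add_apply, Matrix.mul_apply,
    ← Finset.sum_add_distrib]
  exact (HasDerivAt.fun_sum fun k _ => (hM i k).hasDerivAt.fun_mul (hN k j).hasDerivAt).deriv

theorem entryDeriv_isDiag {n : Type*} {M : ℝ → Matrix n n ℝ} {t : ℝ}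
    (h : ∀ᶠ ε in 𝓝 t, (M ε).IsDiag) : (entryDeriv M t).IsDiag := by
  intro i j hij
  have h0 : (fun ε => M ε i j) =ᶠ[𝓝 t] fun _ => (0 : ℝ) := h.mono fun ε hε => hε hij
  simp [entryDeriv, h0.deriv_eq]

/-- First-order perturbation identities (Appendix A) for a differentiable
eigendecomposition `A(ε)X(ε) = X(ε)Λ(ε)` around `A(0) = diag(λI_d, 0)`. -/
theorem eigen_perturbation_first_order
    (d e : ℕ) (hd : 0 < d) (he : 0 < e)
    (lam : ℝ) (hlam : lam ≠ 0)
    (A X Λ : ℝ → Matrix (Fin d ⊕ Fin e) (Fin d ⊕ Fin e) ℝ)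
    (hAdiff : ∀ i j, DifferentiableAt ℝ (fun ε => A ε i j) 0)
    (hXdiff : ∀ i j, DifferentiableAt ℝ (fun ε => X ε i j) 0)
    (hΛdiff : ∀ i j, DifferentiableAt ℝ (fun ε => Λ ε i j) 0)
    (heig : ∀ᶠ ε in 𝓝 (0 : ℝ), A ε * X ε = X ε * Λ ε)
    (hdiag : ∀ᶠ ε in 𝓝 (0 : ℝ), (Λ ε).IsDiag)
    (hA0 : A 0 = Matrix.fromBlocks (lam • (1 : Matrix (Fin d) (Fin d) ℝ)) 0 0
      (0 : Matrix (Fin e) (Fin e) ℝ))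
    (hΛ0 : Λ 0 = A 0)
    (X₁ : Matrix (Fin d) (Fin d) ℝ) (X₂ : Matrix (Fin e) (Fin e) ℝ)
    (hX0 : X 0 = Matrix.fromBlocks X₁ 0 0 X₂)
    (hX₁ : X₁ᵀ * X₁ = 1) (hX₂ : X₂ᵀ * X₂ = 1)
    (A' X' Λ' : Matrix (Fin d ⊕ Fin e) (Fin d ⊕ Fin e) ℝ)
    (hA' : A' = Matrix.of fun i j => deriv (fun ε => A ε i j) 0)
    (hX' : X' = Matrix.of fun i j => deriv (fun ε => X ε i j) 0)
    (hΛ' : Λ' = Matrix.of fun i j => deriv (fun ε => Λ ε i j) 0)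
    (C : Matrix (Fin d ⊕ Fin e) (Fin d ⊕ Fin e) ℝ)
    (hC : C = (X 0)ᵀ * X') :
    A'.toBlocks₁₁ * X₁ = X₁ * Λ'.toBlocks₁₁ ∧
    A'.toBlocks₂₂ * X₂ = X₂ * Λ'.toBlocks₂₂ ∧
    C.toBlocks₁₂ = -lam⁻¹ • (X₁ᵀ * A'.toBlocks₁₂ * X₂) ∧
    C.toBlocks₂₁ = lam⁻¹ • (X₂ᵀ * A'.toBlocks₂₁ * X₁) := by
  have key : A' * X 0 + A 0 * X' = X' * Λ 0 + X 0 * Λ' := by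
    subst hA' hX' hΛ'
    exact (entryDeriv_mul hAdiff hXdiff).symm.trans
      ((entryDeriv_congr heig).trans (entryDeriv_mul hXdiff hΛdiff))
  have hΛ'diag : Λ'.IsDiag := hΛ' ▸ entryDeriv_isDiag hdiag
  have hΛ'₁₂ : Λ'.toBlocks₁₂ = 0 := by
    ext i j
    exact hΛ'diag Sum.inl_ne_inr
  have hΛ'₂₁ : Λ'.toBlocks₂₁ = 0 := by
    ext i j
    exact hΛ'diag Sum.inr_ne_inl
  clear hA' hX' hΛ'
  rw [hΛ0, hA0, hX0, ← fromBlocks_toBlocks A', ← fromBlocks_toBlocks X',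
    ← fromBlocks_toBlocks Λ', hΛ'₁₂, hΛ'₂₁] at key
  simp only [fromBlocks_multiply, fromBlocks_add, fromBlocks_inj, Matrix.mul_zero,
    Matrix.zero_mul, add_zero, zero_add, Matrix.smul_mul, Matrix.mul_smul, Matrix.one_mul,
    Matrix.mul_one] at key
  obtain ⟨h₁₁, h₁₂, h₂₁, h₂₂⟩ := key
  have hX'₁₂ : X'.toBlocks₁₂ = -lam⁻¹ • (A'.toBlocks₁₂ * X₂) := by
    rw [eq_neg_of_add_eq_zero_left h₁₂, neg_smul, smul_neg, neg_neg, inv_smul_smul₀ hlam]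
  have hX'₂₁ : X'.toBlocks₂₁ = lam⁻¹ • (A'.toBlocks₂₁ * X₁) := by
    rw [h₂₁, inv_smul_smul₀ hlam]
  have hCblocks : C = fromBlocks (X₁ᵀ * X'.toBlocks₁₁) (X₁ᵀ * X'.toBlocks₁₂)
      (X₂ᵀ * X'.toBlocks₂₁) (X₂ᵀ * X'.toBlocks₂₂) := by
    rw [hC, hX0, fromBlocks_transpose]
    conv_lhs => rw [← fromBlocks_toBlocks X']
    simp [fromBlocks_multiply]
  refine ⟨add_right_cancel (h₁₁.trans (add_comm _ _)), h₂₂, ?_, ?_⟩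
  · rw [hCblocks, toBlocks_fromBlocks₁₂, hX'₁₂, Matrix.mul_smul, Matrix.mul_assoc]
  · rw [hCblocks, toBlocks_fromBlocks₂₁, hX'₂₁, Matrix.mul_smul, Matrix.mul_assoc]
end

section
/- Let d, q, l be positive integers, p = d + q + l, λ ≠ 0 and γ real numbers. Let A, X, Λ : ℝ → ℝ^{p×p} be matrix-valued functions, twice differentiable at 0, such that for all ε in a neighborhood of 0: A(ε)·X(ε) = X(ε)·Λ(ε) and Λ(ε) is diagonal. Use the 3×3 block decomposition with block sizes d, q, l. Assume: A(0) = Λ(0) has (1,1)-block λ·I_d and all other blocks zero; X(0) is block diagonal diag(I_d, I_q, X₃) with X₃ᵀX₃ = I_l; the (3,3)-block of Λ'(0) equals γ·I_l; the (3,2)-block of A'(0) is zero; and the (3,3)-block of A'(0) equals γ·I_l. Then (A''(0)₃₃ − 2λ⁻¹·A'(0)₃₁·A'(0)₁₃)·X₃ = X₃·Λ''(0)₃₃; that is, the columns of X₃ are eigenvectors of the matrix A''(0)₃₃ − 2λ⁻¹·A'(0)₃₁·A'(0)₁₃ with eigenvalues given by the diagonal entries of the (3,3)-block of Λ''(0).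 -/
open Matrix Filter Topology

/-- First two derivatives of a finite sum of products of twice differentiable functions. -/
theorem deriv_sum_mul_of_twice_differentiable {κ : Type*} [Fintype κ] {f g : κ → ℝ → ℝ} {x : ℝ}
    (hf : ∀ k, (∀ᶠ t in 𝓝 x, DifferentiableAt ℝ (f k) t) ∧ DifferentiableAt ℝ (deriv (f k)) x)
    (hg : ∀ k, (∀ᶠ t in 𝓝 x, DifferentiableAt ℝ (g k) t) ∧ DifferentiableAt ℝ (deriv (g k)) x) :
    deriv (fun t => ∑ k, f k t * g k t) x = ∑ k, (deriv (f k) x * g k x + f k x * deriv (g k) x) ∧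
    iteratedDeriv 2 (fun t => ∑ k, f k t * g k t) x =
      ∑ k, (iteratedDeriv 2 (f k) x * g k x + 2 * (deriv (f k) x * deriv (g k) x) +
        f k x * iteratedDeriv 2 (g k) x) := by
  have h₁ : deriv (fun t => ∑ k, f k t * g k t) =ᶠ[𝓝 x]
      fun t => ∑ k, (deriv (f k) t * g k t + f k t * deriv (g k) t) := by
    filter_upwards [eventually_all.2 fun k => (hf k).1, eventually_all.2 fun k => (hg k).1]
      with t hft hgt
    exact (HasDerivAt.fun_sum fun k _ => (hft k).hasDerivAt.mul (hgt k).hasDerivAt).deriv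
  refine ⟨h₁.eq_of_nhds, ?_⟩
  simp only [iteratedDeriv_succ, iteratedDeriv_zero]
  rw [h₁.deriv_eq]
  refine (HasDerivAt.fun_sum fun k _ =>
    ((hf k).2.hasDerivAt.mul (hg k).1.self_of_nhds.hasDerivAt).add
      ((hf k).1.self_of_nhds.hasDerivAt.mul (hg k).2.hasDerivAt)).deriv.trans ?_
  exact Finset.sum_congr rfl fun k _ => by ring

/-- Off-diagonal derivatives of an eventually diagonal matrix function vanish. -/
theorem iteratedDeriv_apply_eq_zero_of_eventually_isDiag {ι : Type*} {M : ℝ → Matrix ι ι ℝ}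
    {x : ℝ} (h : ∀ᶠ t in 𝓝 x, (M t).IsDiag) (n : ℕ) {i j : ι} (hij : i ≠ j) :
    iteratedDeriv n (fun t => M t i j) x = 0 := by
  have h₀ : (fun t => M t i j) =ᶠ[𝓝 x] fun _ => (0 : ℝ) := h.mono fun t ht => ht hij
  rw [h₀.iteratedDeriv_eq]
  simp

/-- The algebra behind degenerate second-order perturbation theory: the third block column of the
first- and second-order expansions of `A * X = X * Λ`. -/
theorem eq_of_perturbation_expansion {m₁ m₂ m₃ : Type*} [Fintype m₁] [Fintype m₂] [Fintype m₃]
    [DecidableEq m₃] {lam γ : ℝ} (hlam : lam ≠ 0) {A₁₃ X₁₃ : Matrix m₁ m₃ ℝ} {A₃₁ : Matrix m₃ m₁ ℝ}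
    {A₃₂ : Matrix m₃ m₂ ℝ} {X₂₃ : Matrix m₂ m₃ ℝ} {A₃₃ X₃₃ B₃₃ L₃₃ X₃ : Matrix m₃ m₃ ℝ}
    (hA₃₂ : A₃₂ = 0) (hA₃₃ : A₃₃ = γ • 1)
    (h₁ : A₁₃ * X₃ + lam • X₁₃ = 0)
    (h₂ : B₃₃ * X₃ + (2 : ℝ) • (A₃₁ * X₁₃ + (A₃₂ * X₂₃ + A₃₃ * X₃₃)) =
      (2 : ℝ) • (γ • X₃₃) + X₃ * L₃₃) :
    (B₃₃ - (2 * lam⁻¹) • (A₃₁ * A₁₃)) * X₃ = X₃ * L₃₃ := by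
  have hX : A₁₃ * X₃ = -(lam • X₁₃) := eq_neg_of_add_eq_zero_left h₁
  rw [hA₃₂, hA₃₃, Matrix.zero_mul, zero_add, Matrix.smul_mul, Matrix.one_mul, smul_add,
    ← add_assoc, add_comm _ (X₃ * L₃₃)] at h₂
  have h₃ := add_right_cancel h₂
  rw [sub_mul, Matrix.smul_mul, Matrix.mul_assoc, hX, Matrix.mul_neg, Matrix.mul_smul, smul_neg,
    smul_smul, mul_assoc, inv_mul_cancel₀ hlam, mul_one, sub_neg_eq_add, h₃]

/-- Degenerate second-order perturbation result (A.30) of Appendix A: when the first-order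
eigenvalue `γ` repeats with multiplicity `l` (the third block), the zeroth-order
eigenvectors `X₃` and the second-order eigenvalue corrections are obtained from the
eigendecomposition of `A''₃₃ − 2λ⁻¹A'₃₁A'₁₃`. -/
theorem eigen_perturbation_degenerate
    (d q l : ℕ) (hd : 0 < d) (hq : 0 < q) (hl : 0 < l)
    (lam γ : ℝ) (hlam : lam ≠ 0)
    (A X Λ : ℝ → Matrix (Fin d ⊕ (Fin q ⊕ Fin l)) (Fin d ⊕ (Fin q ⊕ Fin l)) ℝ)
    (hAdiff : ∀ i j, (∀ᶠ t in 𝓝 (0 : ℝ), DifferentiableAt ℝ (fun ε => A ε i j) t) ∧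
      DifferentiableAt ℝ (deriv fun ε => A ε i j) 0)
    (hXdiff : ∀ i j, (∀ᶠ t in 𝓝 (0 : ℝ), DifferentiableAt ℝ (fun ε => X ε i j) t) ∧
      DifferentiableAt ℝ (deriv fun ε => X ε i j) 0)
    (hΛdiff : ∀ i j, (∀ᶠ t in 𝓝 (0 : ℝ), DifferentiableAt ℝ (fun ε => Λ ε i j) t) ∧
      DifferentiableAt ℝ (deriv fun ε => Λ ε i j) 0)
    (heig : ∀ᶠ ε in 𝓝 (0 : ℝ), A ε * X ε = X ε * Λ ε)
    (hdiag : ∀ᶠ ε in 𝓝 (0 : ℝ), (Λ ε).IsDiag)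
    (hA0 : A 0 = Matrix.fromBlocks (lam • (1 : Matrix (Fin d) (Fin d) ℝ)) 0 0
      (0 : Matrix (Fin q ⊕ Fin l) (Fin q ⊕ Fin l) ℝ))
    (hΛ0 : Λ 0 = A 0)
    (X₃ : Matrix (Fin l) (Fin l) ℝ) (hX₃ : X₃ᵀ * X₃ = 1)
    (hX0 : X 0 = Matrix.fromBlocks (1 : Matrix (Fin d) (Fin d) ℝ) 0 0
      (Matrix.fromBlocks (1 : Matrix (Fin q) (Fin q) ℝ) 0 0 X₃))
    (A' Λ' A'' Λ'' : Matrix (Fin d ⊕ (Fin q ⊕ Fin l)) (Fin d ⊕ (Fin q ⊕ Fin l)) ℝ)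
    (hA' : A' = Matrix.of fun i j => deriv (fun ε => A ε i j) 0)
    (hΛ' : Λ' = Matrix.of fun i j => deriv (fun ε => Λ ε i j) 0)
    (hA'' : A'' = Matrix.of fun i j => iteratedDeriv 2 (fun ε => A ε i j) 0)
    (hΛ'' : Λ'' = Matrix.of fun i j => iteratedDeriv 2 (fun ε => Λ ε i j) 0)
    (hΛ'33 : (Matrix.of fun i j : Fin l =>
        Λ' (Sum.inr (Sum.inr i)) (Sum.inr (Sum.inr j))) =
      γ • (1 : Matrix (Fin l) (Fin l) ℝ))
    (hA'32 : (Matrix.of fun (i : Fin l) (j : Fin q) =>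
        A' (Sum.inr (Sum.inr i)) (Sum.inr (Sum.inl j))) = 0)
    (hA'33 : (Matrix.of fun i j : Fin l =>
        A' (Sum.inr (Sum.inr i)) (Sum.inr (Sum.inr j))) =
      γ • (1 : Matrix (Fin l) (Fin l) ℝ)) :
    (Matrix.of fun i j : Fin l =>
        Λ'' (Sum.inr (Sum.inr i)) (Sum.inr (Sum.inr j))).IsDiag ∧
    ((Matrix.of fun i j : Fin l => A'' (Sum.inr (Sum.inr i)) (Sum.inr (Sum.inr j))) -
        (2 * lam⁻¹) •
          ((Matrix.of fun (i : Fin l) (j : Fin d) => A' (Sum.inr (Sum.inr i)) (Sum.inl j)) *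
            (Matrix.of fun (i : Fin d) (j : Fin l) =>
              A' (Sum.inl i) (Sum.inr (Sum.inr j))))) * X₃ =
      X₃ * (Matrix.of fun i j : Fin l => Λ'' (Sum.inr (Sum.inr i)) (Sum.inr (Sum.inr j))) := by
  have hΛoff (n : ℕ) {i j} (hij : i ≠ j) : iteratedDeriv n (fun ε => Λ ε i j) 0 = 0 :=
    iteratedDeriv_apply_eq_zero_of_eventually_isDiag hdiag n hij
  have hΛoff₁ {i j} (hij : i ≠ j) : deriv (fun ε => Λ ε i j) 0 = 0 := by
    simpa only [iteratedDeriv_one] using hΛoff 1 hij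
  have hent (i j) : (fun ε => ∑ k, A ε i k * X ε k j) =ᶠ[𝓝 0]
      fun ε => ∑ k, X ε i k * Λ ε k j :=
    heig.mono fun ε h => by simpa only [Matrix.mul_apply] using congrFun₂ h i j
  have hAX (i j) := deriv_sum_mul_of_twice_differentiable
    (fun k => hAdiff i k) (fun k => hXdiff k j)
  have hXΛ (i j) := deriv_sum_mul_of_twice_differentiable
    (fun k => hXdiff i k) (fun k => hΛdiff k j)
  have hfirst (i j) := (hAX i j).1.symm.trans ((hent i j).deriv_eq.trans (hXΛ i j).1)
  have hsecond (i j) := (hAX i j).2.symm.trans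
    (((hent i j).iteratedDeriv_eq 2).trans (hXΛ i j).2)
  subst hA' hΛ' hA'' hΛ''
  have hΛ33 (i j : Fin l) :
      deriv (fun ε => Λ ε (Sum.inr (Sum.inr i)) (Sum.inr (Sum.inr j))) 0 =
        γ * (1 : Matrix (Fin l) (Fin l) ℝ) i j := by
    simpa using congrFun₂ hΛ'33 i j
  refine ⟨fun i j hij => by simpa using hΛoff 2 (by simpa using hij), ?_⟩
  refine eq_of_perturbation_expansion (γ := γ) (m₁ := Fin d) (m₂ := Fin q) (m₃ := Fin l) hlam
    (X₁₃ := Matrix.of fun i j => deriv (fun ε => X ε (Sum.inl i) (Sum.inr (Sum.inr j))) 0)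
    (X₂₃ := Matrix.of fun i j =>
      deriv (fun ε => X ε (Sum.inr (Sum.inl i)) (Sum.inr (Sum.inr j))) 0)
    (X₃₃ := Matrix.of fun i j =>
      deriv (fun ε => X ε (Sum.inr (Sum.inr i)) (Sum.inr (Sum.inr j))) 0)
    hA'32 hA'33 ?_ ?_
  · ext i j
    have h := hfirst (Sum.inl i) (Sum.inr (Sum.inr j))
    simpa [hΛ0, hA0, hX0, Matrix.mul_apply, Matrix.one_apply, Finset.sum_add_distrib, hΛoff₁]
      using h
  · ext i j
    have h := hsecond (Sum.inr (Sum.inr i)) (Sum.inr (Sum.inr j))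
    simpa [hΛ0, hA0, hX0, Matrix.mul_apply, Matrix.one_apply, Finset.sum_add_distrib, hΛoff₁,
      hΛ33, ← Finset.mul_sum, mul_add, mul_comm γ] using h
end
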